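/- Let ((Φ^{(i)})_{i∈I}, (p_i)_{i∈I}, ℙ) be a Bernoulli model with all contraction ratios r_i ∈ (0,1), satisfying the strong separation condition, and such that for every ω ∈ I^ℕ the pairwise distances between the sets f^{(ω_1)}_u(Y^{(σω)}) are greater than 2. Let ℙ' be the law of the random pair (ω, u) where ω ∼ ℙ and, conditionally on ω, u ∼ η̄^{(ω)}. Let Q̄ be the normalized restriction of ℙ' × Lebesgue to {(ω, u, t) : 0 ≤ t < -log r_{ω_1}} (i.e. Q̄ = (ℙ' × λ)|_{{0 ≤ t < -log r_{ω_1}}} divided by ∫ -log r_{ω_1} dℙ(ω)), and let Q be the pushforward of Q̄ under the map (ω, u, t) ↦ S_t η_{ω,u}, a Borel probability measure on 𝒫([-1,1]). Then for ℙ-almost every ω and η̄^{(ω)}-almost every u, the scenery of η^{(ω)} at Π_ω(u) equidistributes for Q: for every continuous f : 𝒫([-1,1]) → ℝ (weak topology), (1/T)·∫_0^T f(S_t η_{ω,u}) dt → ∫ f dQ as T → ∞. -/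

import Mathlib

open MeasureTheory Filter Topology

noncomputable section

/-- The left shift on sequences. -/
def shiftSeq {I : Type*} (ω : ℕ → I) : ℕ → I := fun n => ω (n + 1)

/-- The coding map `Π_ω(u) = Σ_{n} (Π_{j<n} r_{ω_j}) · t^{(ω_n)}_{u_n}` of a model. -/
def coding {I : Type*} (k : I → ℕ) (r : I → ℝ) (t : (i : I) → Fin (k i) → ℝ)
    (ω : ℕ → I) (u : (n : ℕ) → Fin (k (ω n))) : ℝ :=
  ∑' n : ℕ, (∏ j ∈ Finset.range n, r (ω j)) * t (ω n) (u n)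

/-- The set `Y^{(ω)}`, the image of the coding map. -/
def Yset {I : Type*} (k : I → ℕ) (r : I → ℝ) (t : (i : I) → Fin (k i) → ℝ)
    (ω : ℕ → I) : Set ℝ :=
  Set.range (coding k r t ω)

/-- The measure `η^{(ω)} = (Π_ω)₌ η̄^{(ω)}`. -/
def etaMeas {I : Type*} (k : I → ℕ) (r : I → ℝ) (t : (i : I) → Fin (k i) → ℝ)
    (η' : (ω : ℕ → I) → Measure ((n : ℕ) → Fin (k (ω n)))) (ω : ℕ → I) : Measure ℝ :=
  Measure.map (coding k r t ω) (η' ω)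

/-- The recentering of a measure `η` at `x`: `η_x(E) = η(E + x) / η([x-1,x+1])` for Borel
`E ⊆ [-1,1]` (realized as a measure on `ℝ` supported on `[-1,1]`). -/
def recenter (η : Measure ℝ) (x : ℝ) : Measure ℝ :=
  (η (Set.Icc (x - 1) (x + 1)))⁻¹ •
    (Measure.map (fun y => y - x) η).restrict (Set.Icc (-1 : ℝ) 1)

/-- The scaling flow: `S_τ ν (E) = ν(e^{-τ}·E) / ν([-e^{-τ}, e^{-τ}])` for Borel
`E ⊆ [-1,1]` (realized as a measure on `ℝ` supported on `[-1,1]`). -/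
def scaleM (τ : ℝ) (ν : Measure ℝ) : Measure ℝ :=
  (ν (Set.Icc (-(Real.exp (-τ))) (Real.exp (-τ))))⁻¹ •
    (Measure.map (fun y => Real.exp τ * y) ν).restrict (Set.Icc (-1 : ℝ) 1)

open Classical in
/-- Package a measure on `ℝ` as a probability measure (with an irrelevant junk value when
it is not a probability measure). -/
def toProb (ν : Measure ℝ) : ProbabilityMeasure ℝ :=
  if h : IsProbabilityMeasure ν then ⟨ν, h⟩ else ⟨Measure.dirac 0, by infer_instance⟩

/-- The scenery of `η^{(ω)}` at `Π_ω(u)` at time `τ`, as a probability measure on `ℝ`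
(supported on `[-1,1]`). -/
def scenery {I : Type*} (k : I → ℕ) (r : I → ℝ) (t : (i : I) → Fin (k i) → ℝ)
    (η' : (ω : ℕ → I) → Measure ((n : ℕ) → Fin (k (ω n))))
    (ω : ℕ → I) (u : (n : ℕ) → Fin (k (ω n))) (τ : ℝ) : ProbabilityMeasure ℝ :=
  toProb (scaleM τ (recenter (etaMeas k r t η' ω) (coding k r t ω u)))

/-- Two measures on sequences over finite types agree if they agree on cylinders. -/
theorem ext_of_cylinder {α : ℕ → Type*} [∀ n, Finite (α n)] [∀ n, MeasurableSpace (α n)]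
    [∀ n, DiscreteMeasurableSpace (α n)] {μ ν : Measure (∀ n, α n)} [IsFiniteMeasure μ]
    (h : ∀ (n : ℕ) (c : ∀ n, α n), μ {u | ∀ j < n, u j = c j} = ν {u | ∀ j < n, u j = c j}) :
    μ = ν := by
  rcases isEmpty_or_nonempty (∀ n, α n) with he | ⟨⟨c₀⟩⟩
  · rw [Measure.eq_zero_of_isEmpty μ, Measure.eq_zero_of_isEmpty ν]
  let Q : (S : Finset ℕ) → Measure (∀ j : S, α j) := fun S => μ.map S.restrict
  have hμ : IsProjectiveLimit μ Q := fun S => rfl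
  have hQ : IsProjectiveMeasureFamily Q := fun S T hT => by
    rw [Measure.map_map (by fun_prop) (by fun_prop)]; rfl
  have hν : IsProjectiveLimit ν Q := by
    rw [isProjectiveLimit_nat_iff hQ]
    intro n
    refine (Measure.ext_of_singleton fun a => ?_).symm
    let c : ∀ n, α n := fun m => if hm : m ∈ Finset.Iic n then a ⟨m, hm⟩ else c₀ m
    have key : Preorder.frestrictLe n ⁻¹' {a} = {u : ∀ n, α n | ∀ j < n + 1, u j = c j} := by
      ext u
      simp only [Set.mem_preimage, Set.mem_singleton_iff, Set.mem_ofPred_eq, funext_iff,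
        Subtype.forall, Preorder.frestrictLe_apply]
      refine ⟨fun H j hj => ?_, fun H j hj => ?_⟩
      · have hj' : j ∈ Finset.Iic n := Finset.mem_Iic.2 (by lia)
        simpa [c, show j ≤ n by lia] using H j hj'
      · have := H j (by have := Finset.mem_Iic.1 hj; lia)
        simpa [c, Finset.mem_Iic.1 hj] using this
    have key' : (Finset.Iic n).restrict ⁻¹' {a} = {u : ∀ n, α n | ∀ j < n + 1, u j = c j} := key
    rw [Measure.map_apply (by fun_prop) (measurableSet_singleton a),
      Measure.map_apply (by fun_prop) (measurableSet_singleton a), key, key', h]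
  exact hμ.unique hν

theorem tendsto_average_of_residues {h : ℕ → ℝ} {C c : ℝ} (hC : ∀ m, |h m| ≤ C) {n : ℕ}
    (hn : 0 < n)
    (H : ∀ a < n, Tendsto (fun L : ℕ => (∑ l ∈ Finset.range L, h (a + n * l)) / L) atTop (𝓝 c)) :
    Tendsto (fun N : ℕ => (∑ m ∈ Finset.range N, h m) / N) atTop (𝓝 c) := by
  have hn' : (0 : ℝ) < n := by exact_mod_cast hn
  have hC0 : 0 ≤ C := (abs_nonneg _).trans (hC 0)
  have hblock : ∀ L : ℕ, ∑ m ∈ Finset.range (n * L), h m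
      = ∑ a ∈ Finset.range n, ∑ l ∈ Finset.range L, h (a + n * l) := by
    intro L
    induction L with
    | zero => simp
    | succ L ih =>
      rw [Nat.mul_succ, Finset.sum_range_add, ih, ← Finset.sum_add_distrib]
      refine Finset.sum_congr rfl fun a _ => ?_
      rw [Finset.sum_range_succ, add_comm (n * L) a]
  have hdiv : Tendsto (fun N : ℕ => N / n) atTop atTop := Nat.tendsto_div_const_atTop hn.ne'
  have hratio : Tendsto (fun N : ℕ => ((N / n : ℕ) : ℝ) / N) atTop (𝓝 (n : ℝ)⁻¹) := by
    have := (tendsto_nat_floor_mul_div_atTop (R := ℝ) (a := (n : ℝ)⁻¹) (by positivity)).comp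
      tendsto_natCast_atTop_atTop
    refine this.congr fun N => ?_
    simp only [Function.comp]
    rw [inv_mul_eq_div, Nat.floor_div_eq_div]
  have hmain : Tendsto (fun N : ℕ => (∑ m ∈ Finset.range (n * (N / n)), h m) / N) atTop (𝓝 c) := by
    have h1 : Tendsto (fun N : ℕ => (∑ a ∈ Finset.range n,
        (∑ l ∈ Finset.range (N / n), h (a + n * l)) / ((N / n : ℕ) : ℝ)) * (((N / n : ℕ) : ℝ) / N))
        atTop (𝓝 ((∑ a ∈ Finset.range n, c) * (n : ℝ)⁻¹)) :=
      (tendsto_finsetSum _ fun a ha => (H a (Finset.mem_range.1 ha)).comp hdiv).mul hratio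
    have h2 : (∑ a ∈ Finset.range n, c) * (n : ℝ)⁻¹ = c := by
      simp; field_simp
    rw [h2] at h1
    refine h1.congr' ?_
    filter_upwards [eventually_ge_atTop n] with N hN
    have : ((N / n : ℕ) : ℝ) ≠ 0 := by
      exact_mod_cast (Nat.div_pos hN hn).ne'
    rw [hblock, ← Finset.sum_div]
    field_simp
  have hrem : Tendsto (fun N : ℕ => (∑ m ∈ Finset.range N, h m) / N
      - (∑ m ∈ Finset.range (n * (N / n)), h m) / N) atTop (𝓝 0) := by
    refine squeeze_zero_norm (a := fun N : ℕ => (n * C) / (N : ℝ)) (fun N => ?_)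
      (tendsto_const_div_atTop_nhds_zero_nat _)
    rw [← sub_div, norm_div, Real.norm_natCast]
    gcongr
    conv_lhs => rw [← Nat.div_add_mod N n, Finset.sum_range_add]
    have e : n * ((n * (N / n) + N % n) / n) = n * (N / n) := by rw [Nat.div_add_mod]
    rw [e, add_sub_cancel_left]
    calc ‖∑ m ∈ Finset.range (N % n), h (n * (N / n) + m)‖
        ≤ ∑ m ∈ Finset.range (N % n), C := norm_sum_le_of_le _ fun m _ => hC _
      _ = (N % n : ℕ) * C := by simp
      _ ≤ n * C := by gcongr; exact (Nat.mod_lt _ hn).le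
  simpa using hrem.add hmain

open ProbabilityTheory in
/-- The ergodic theorem for window functions of an i.i.d. sequence: along each residue class the
windows are independent, so that the strong law applies. -/
theorem ae_tendsto_average_window {J : Type*} [Finite J] [MeasurableSpace J]
    [DiscreteMeasurableSpace J] (β : Measure J) [IsProbabilityMeasure β] (n : ℕ)
    (g : (Fin n → J) → ℝ) :
    ∀ᵐ x ∂(Measure.infinitePi fun _ : ℕ => β),
      Tendsto (fun N : ℕ => (∑ m ∈ Finset.range N, g fun j => x (m + j)) / N) atTop
        (𝓝 (∫ x, g (fun j => x j) ∂(Measure.infinitePi fun _ : ℕ => β))) := by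
  set B := Measure.infinitePi fun _ : ℕ => β
  have hgm : Measurable g := measurable_of_finite g
  obtain ⟨C, hC⟩ : ∃ C, ∀ y, |g y| ≤ C := by
    obtain ⟨C, hC⟩ := (Set.finite_range fun y => |g y|).bddAbove
    exact ⟨C, fun y => hC ⟨y, rfl⟩⟩
  rcases Nat.eq_zero_or_pos n with rfl | hn
  · refine Eventually.of_forall fun x => ?_
    have : ∀ y : Fin 0 → J, g y = g default := fun y => by congr; exact Subsingleton.elim _ _
    simp only [this, Finset.sum_const, Finset.card_range, nsmul_eq_mul, integral_const,
      probReal_univ, one_smul]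
    refine tendsto_const_nhds.congr' ?_
    filter_upwards [eventually_gt_atTop 0] with N hN
    field_simp
  have hwin : ∀ a : ℕ, Measurable fun x : ℕ → J => fun j : Fin n => x (a + j) := fun a => by
    fun_prop
  have hmap : ∀ a : ℕ, B.map (fun x : ℕ → J => fun j : Fin n => x (a + j))
      = Measure.infinitePi fun _ : Fin n => β := fun a =>
    Measure.map_infinitePi_infinitePi_of_inj (f := fun j : Fin n => a + (j : ℕ))
      (fun i j hij => by ext; simpa using hij)
  have hint : ∀ a : ℕ, ∫ x, g (fun j => x (a + j)) ∂B = ∫ x, g (fun j => x j) ∂B := by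
    intro a
    have h1 := integral_map (μ := B) (hwin a).aemeasurable (f := g) hgm.aestronglyMeasurable
    have h2 := integral_map (μ := B) (hwin 0).aemeasurable (f := g) hgm.aestronglyMeasurable
    rw [hmap] at h1 h2
    simpa using h1.symm.trans h2
  have hres : ∀ a < n, ∀ᵐ x ∂B, Tendsto (fun L : ℕ =>
      (∑ l ∈ Finset.range L, g fun j => x (a + n * l + j)) / L) atTop
        (𝓝 (∫ x, g (fun j => x j) ∂B)) := by
    intro a _
    have := strong_law_ae_real (μ := B) (fun l x => g fun j => x (a + n * l + j)) ?_ ?_ ?_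
    · simpa only [hint] using this
    · exact Integrable.of_bound (hgm.comp (hwin _)).aestronglyMeasurable C
        (Eventually.of_forall fun x => hC _)
    · intro l l' hll'
      have hI : iIndepFun (fun (i : ℕ) (x : ℕ → J) => x i) B :=
        iIndepFun_infinitePi (X := fun _ y => y) fun _ => measurable_id
      let S : ℕ → Finset ℕ := fun l => Finset.univ.image fun j : Fin n => a + n * l + (j : ℕ)
      have hS : Disjoint (S l) (S l') := by
        rw [Finset.disjoint_left]
        intro m hm hm'
        simp only [S, Finset.mem_image, Finset.mem_univ, true_and] at hm hm'
        obtain ⟨j, hj⟩ := hm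
        obtain ⟨j', hj'⟩ := hm'
        apply hll'
        have e : n * l + j = n * l' + j' := by lia
        have e1 : (n * l + j) / n = l := by
          rw [Nat.mul_add_div hn, Nat.div_eq_of_lt j.2, add_zero]
        have e2 : (n * l' + j') / n = l' := by
          rw [Nat.mul_add_div hn, Nat.div_eq_of_lt j'.2, add_zero]
        rw [← e1, ← e2, e]
      have hi := hI.indepFun_finset (S l) (S l') hS fun i => measurable_pi_apply i
      have hmem : ∀ l (j : Fin n), a + n * l + (j : ℕ) ∈ S l := fun l j =>
        Finset.mem_image_of_mem _ (Finset.mem_univ j)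
      exact hi.comp (φ := fun y => g fun j => y ⟨_, hmem l j⟩)
        (ψ := fun y => g fun j => y ⟨_, hmem l' j⟩) (hgm.comp (by fun_prop))
        (hgm.comp (by fun_prop))
    · intro l
      have : ∀ a, IdentDistrib (fun (x : ℕ → J) (j : Fin n) => x (a + j))
          (fun (x : Fin n → J) => x) B (Measure.infinitePi fun _ : Fin n => β) := fun a =>
        ⟨(hwin a).aemeasurable, measurable_id.aemeasurable, by rw [hmap]; exact Measure.map_id.symm⟩
      exact ((this _).trans (this _).symm).comp hgm
  have hall : ∀ᵐ x ∂B, ∀ a < n, Tendsto (fun L : ℕ =>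
      (∑ l ∈ Finset.range L, g fun j => x (a + n * l + j)) / L) atTop
        (𝓝 (∫ x, g (fun j => x j) ∂B)) := by
    rw [ae_all_iff]
    intro a
    by_cases ha : a < n
    · simpa [ha] using hres a ha
    · simp [ha]
  filter_upwards [hall] with x hx
  exact tendsto_average_of_residues (h := fun m => g fun j => x (m + j)) (fun m => hC _) hn hx

theorem exists_truncation_close {J : Type*} [Finite J] [TopologicalSpace J] [DiscreteTopology J]
    {G : (ℕ → J) → ℝ} (hG : Continuous G) (b : J) {ε : ℝ} (hε : 0 < ε) :
    ∃ n : ℕ, ∀ y : ℕ → J, |G y - G fun j => if j < n then y j else b| < ε := by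
  by_contra! H
  choose y hy using H
  obtain ⟨z, φ, hφ, hz⟩ := CompactSpace.tendsto_subseq y
  have hz' : Tendsto (fun m => (fun j => if j < φ m then y (φ m) j else b : ℕ → J)) atTop (𝓝 z) := by
    rw [tendsto_pi_nhds] at hz ⊢
    intro j
    refine (hz j).congr' ?_
    filter_upwards [hφ.tendsto_atTop.eventually_gt_atTop j] with m hm
    simp [hm]
  have h0 : Tendsto (fun m => |G (y (φ m)) - G fun j => if j < φ m then y (φ m) j else b|) atTop
      (𝓝 0) := by
    have := (((hG.tendsto z).comp hz).sub ((hG.tendsto z).comp hz')).abs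
    simpa using this
  obtain ⟨m, hm⟩ := (h0.eventually_lt_const hε).exists
  exact absurd hm (not_lt.2 (hy (φ m)))

/-- Almost every point of a Bernoulli shift is generic for all continuous functions. -/
theorem ae_tendsto_average_continuous {J : Type*} [Finite J] [TopologicalSpace J]
    [DiscreteTopology J] [MeasurableSpace J] [DiscreteMeasurableSpace J] (β : Measure J)
    [IsProbabilityMeasure β] :
    ∀ᵐ x ∂(Measure.infinitePi fun _ : ℕ => β), ∀ G : (ℕ → J) → ℝ, Continuous G →
      Tendsto (fun N : ℕ => (∑ m ∈ Finset.range N, G fun j => x (m + j)) / N) atTop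
        (𝓝 (∫ y, G y ∂(Measure.infinitePi fun _ : ℕ => β))) := by
  classical
  set B := Measure.infinitePi fun _ : ℕ => β
  have := Fintype.ofFinite J
  have hcyl : ∀ᵐ x ∂B, ∀ (n : ℕ) (c : Fin n → J),
      Tendsto (fun N : ℕ => (∑ m ∈ Finset.range N,
        if (fun j : Fin n => x (m + j)) = c then (1 : ℝ) else 0) / N) atTop
        (𝓝 (∫ x : ℕ → J, (if (fun j : Fin n => x j) = c then (1 : ℝ) else 0) ∂B)) := by
    simp only [ae_all_iff]
    exact fun n c => ae_tendsto_average_window β n fun y => if y = c then 1 else 0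
  filter_upwards [hcyl] with x hx G hG
  have hwin : ∀ (n : ℕ) (g : (Fin n → J) → ℝ),
      Tendsto (fun N : ℕ => (∑ m ∈ Finset.range N, g fun j => x (m + j)) / N) atTop
        (𝓝 (∫ x, g (fun j => x j) ∂B)) := by
    intro n g
    have hg : ∀ y, g y = ∑ c, g c * if y = c then 1 else 0 := fun y => by simp
    have e : ∫ x, g (fun j => x j) ∂B
        = ∑ c, g c * ∫ x : ℕ → J, (if (fun j : Fin n => x j) = c then (1 : ℝ) else 0) ∂B := by
      simp_rw [← integral_const_mul]
      rw [← integral_finsetSum]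
      · exact integral_congr_ae (Eventually.of_forall fun y => hg _)
      · intro c _
        have hm : Measurable fun y : Fin n → J => g c * if y = c then (1 : ℝ) else 0 :=
          measurable_of_finite _
        have hw : Measurable fun (x : ℕ → J) (j : Fin n) => x j := by fun_prop
        refine Integrable.of_bound (hm.comp hw).aestronglyMeasurable |g c|
          (Eventually.of_forall fun y => ?_)
        simp only [Real.norm_eq_abs, abs_mul]
        split_ifs <;> simp
    rw [e]
    refine (tendsto_finsetSum _ fun c _ => (hx n c).const_mul (g c)).congr fun N => ?_
    simp_rw [hg (fun j => x (_ + (j : ℕ)))]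
    rw [Finset.sum_comm, Finset.sum_div]
    simp_rw [← Finset.mul_sum, mul_div_assoc]
  rw [Metric.tendsto_atTop]
  intro ε hε
  obtain ⟨n, hn⟩ := exists_truncation_close hG (x 0) (show 0 < ε / 3 by positivity)
  have hcont : Continuous fun y : ℕ → J => G fun j => if j < n then y j else x 0 := by
    refine hG.comp (continuous_pi fun j => ?_)
    split_ifs <;> fun_prop
  have hmeas : ∀ {F : (ℕ → J) → ℝ}, Continuous F → Integrable F B := by
    intro F hF
    have : SecondCountableTopology J := inferInstance
    obtain ⟨C, hC⟩ := (isCompact_range hF).isBounded.exists_norm_le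
    exact Integrable.of_bound hF.measurable.aestronglyMeasurable C
      (Eventually.of_forall fun y => hC _ ⟨y, rfl⟩)
  have hint : |∫ y, G y ∂B - ∫ y, G (fun j => if j < n then y j else x 0) ∂B| ≤ ε / 3 := by
    rw [← integral_sub (hmeas hG) (hmeas hcont)]
    have := norm_integral_le_of_norm_le_const (μ := B) (C := ε / 3)
      (f := fun y => G y - G fun j => if j < n then y j else x 0)
      (Eventually.of_forall fun y => (hn y).le)
    simpa using this
  let g : (Fin n → J) → ℝ := fun c => G fun j => if h : j < n then c ⟨j, h⟩ else x 0
  have hg : ∀ y : ℕ → J, (G fun j => if j < n then y j else x 0) = g fun j => y j := by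
    intro y
    simp only [g]
    congr 1
  obtain ⟨N₀, hN₀⟩ := Metric.tendsto_atTop.1 (hwin n g) (ε / 3) (by positivity)
  refine ⟨N₀ + 1, fun N hN => ?_⟩
  have hNpos : (0 : ℝ) < N := by exact_mod_cast (show 0 < N by lia)
  have h1 := hN₀ N (by lia)
  have h2 : |(∑ m ∈ Finset.range N, G fun j => x (m + j)) / N
      - (∑ m ∈ Finset.range N, g fun j => x (m + j)) / N| ≤ ε / 3 := by
    rw [← sub_div, ← Finset.sum_sub_distrib, abs_div, Nat.abs_cast, div_le_iff₀ hNpos]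
    calc _ ≤ ∑ m ∈ Finset.range N, ε / 3 := by
          refine (Finset.abs_sum_le_sum_abs _ _).trans (Finset.sum_le_sum fun m _ => ?_)
          have := (hn fun j => x (m + j)).le
          rwa [hg] at this
      _ = ε / 3 * N := by simp; ring
  simp_rw [hg] at hint
  rw [Real.dist_eq] at h1 ⊢
  rw [abs_lt] at h1 ⊢
  rw [abs_le] at h2 hint
  constructor <;> linarith

theorem tendsto_time_average {φ : ℝ → ℝ} {M : ℝ} (hM : ∀ τ, |φ τ| ≤ M)
    (hφ : ∀ a b, IntervalIntegrable φ volume a b) {S : ℕ → ℝ} {l A : ℝ} (hl : 0 < l)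
    (hS : Tendsto (fun m : ℕ => S m / m) atTop (𝓝 l))
    (hA : Tendsto (fun m : ℕ => (∫ τ in (0 : ℝ)..S m, φ τ) / m) atTop (𝓝 A)) :
    Tendsto (fun T : ℝ => T⁻¹ * ∫ τ in (0 : ℝ)..T, φ τ) atTop (𝓝 (l⁻¹ * A)) := by
  let n : ℝ → ℕ := fun T => ⌊l⁻¹ * T⌋₊
  have hn : Tendsto n atTop atTop :=
    tendsto_nat_floor_atTop.comp (tendsto_id.const_mul_atTop (inv_pos.2 hl))
  have hratio : Tendsto (fun T : ℝ => (n T : ℝ) / T) atTop (𝓝 l⁻¹) :=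
    tendsto_nat_floor_mul_div_atTop (inv_pos.2 hl).le
  have hpos : ∀ᶠ T in atTop, (n T : ℝ) ≠ 0 := by
    filter_upwards [hn.eventually_gt_atTop 0] with T hT
    exact_mod_cast hT.ne'
  have h1 : Tendsto (fun T : ℝ => T⁻¹ * ∫ τ in (0 : ℝ)..S (n T), φ τ) atTop (𝓝 (l⁻¹ * A)) := by
    refine (hratio.mul (hA.comp hn)).congr' ?_
    filter_upwards [hpos] with T hT
    simp only [Function.comp]
    field_simp
  have h2 : Tendsto (fun T : ℝ => S (n T) / T) atTop (𝓝 1) := by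
    have := hratio.mul (hS.comp hn)
    rw [inv_mul_cancel₀ hl.ne'] at this
    refine this.congr' ?_
    filter_upwards [hpos] with T hT
    simp only [Function.comp]
    field_simp
  have h3 : Tendsto (fun T : ℝ => T⁻¹ * (∫ τ in (0 : ℝ)..T, φ τ)
      - T⁻¹ * ∫ τ in (0 : ℝ)..S (n T), φ τ) atTop (𝓝 0) := by
    refine squeeze_zero_norm' (a := fun T : ℝ => M * |1 - S (n T) / T|) ?_ ?_
    · filter_upwards [eventually_gt_atTop 0] with T hT
      rw [← mul_sub, intervalIntegral.integral_interval_sub_left (hφ _ _) (hφ _ _)]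
      have := intervalIntegral.norm_integral_le_of_norm_le_const (a := S (n T)) (b := T) (f := φ)
        (C := M) fun τ _ => hM τ
      rw [norm_mul, norm_inv, Real.norm_of_nonneg hT.le]
      calc T⁻¹ * _ ≤ T⁻¹ * (M * |T - S (n T)|) := by gcongr
        _ = M * |1 - S (n T) / T| := by
          rw [one_sub_div hT.ne', abs_div, abs_of_pos hT]; ring
    · simpa using ((tendsto_const_nhds (x := (1 : ℝ))).sub h2).abs.const_mul M
  simpa using h3.add h1

/-- The coding map `coding`, as a function of the sequence of pairs `(ω n, u n)`. -/
def codeSeq {I : Type*} (k : I → ℕ) (r : I → ℝ) (t : (i : I) → Fin (k i) → ℝ)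
    (x : ℕ → Σ i, Fin (k i)) : ℝ :=
  coding k r t (fun n => (x n).1) fun n => (x n).2

/-- Replace the digits of `x` by those prescribed by the choice functions `θ`. -/
def redigit {I : Type*} {k : I → ℕ} (x : ℕ → Σ i, Fin (k i)) (θ : ℕ → (i : I) → Fin (k i)) :
    ℕ → Σ i, Fin (k i) :=
  fun n => ⟨(x n).1, θ n (x n).1⟩

/-- The position, seen from the point coded by `x` and magnified by `exp τ`, of the point with
the same parameters as `x` and with digits prescribed by `θ`. -/
def magnify {I : Type*} (k : I → ℕ) (r : I → ℝ) (t : (i : I) → Fin (k i) → ℝ)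
    (x : ℕ → Σ i, Fin (k i)) (τ : ℝ) (θ : ℕ → (i : I) → Fin (k i)) : ℝ :=
  Real.exp τ * (codeSeq k r t (redigit x θ) - codeSeq k r t x)

/-- The law of an independent sequence of independent choices of digits. -/
def choiceLaw {I : Type*} [Fintype I] {k : I → ℕ} (π : (i : I) → Measure (Fin (k i)))
    [∀ i, IsProbabilityMeasure (π i)] : Measure (ℕ → (i : I) → Fin (k i)) :=
  Measure.infinitePi fun _ => Measure.pi π

instance {I : Type*} [Fintype I] {k : I → ℕ} (π : (i : I) → Measure (Fin (k i)))
    [∀ i, IsProbabilityMeasure (π i)] : IsProbabilityMeasure (choiceLaw π) := by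
  unfold choiceLaw; infer_instance

/-- The scenery at the point coded by `x`, expressed through independent choices of digits. -/
def choiceScenery {I : Type*} [Fintype I] (k : I → ℕ) (r : I → ℝ)
    (t : (i : I) → Fin (k i) → ℝ) (π : (i : I) → Measure (Fin (k i)))
    [∀ i, IsProbabilityMeasure (π i)] (x : ℕ → Σ i, Fin (k i)) (τ : ℝ) :
    ProbabilityMeasure ℝ :=
  toProb (ProbabilityTheory.cond ((choiceLaw π).map (magnify k r t x τ)) (Set.Icc (-1) 1))

section Coding

variable {I : Type*} [Fintype I] {k : I → ℕ} {r : I → ℝ}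

theorem exists_coding_bound (hr : ∀ i, r i ∈ Set.Ioo (0 : ℝ) 1) (t : (i : I) → Fin (k i) → ℝ) :
    ∃ ρ K : ℝ, 0 ≤ ρ ∧ ρ < 1 ∧ ∀ (n : ℕ) (x : ℕ → Σ i, Fin (k i)),
      ‖(∏ j ∈ Finset.range n, r (x j).1) * t (x n).1 (x n).2‖ ≤ ρ ^ n * K := by
  obtain ⟨K, hK⟩ := (Set.finite_range fun a : Σ i, Fin (k i) => |t a.1 a.2|).bddAbove
  rcases isEmpty_or_nonempty I with hI | hI
  · exact ⟨0, 0, le_rfl, one_pos, fun n x => isEmptyElim (x 0).1⟩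
  obtain ⟨i₀, hi₀⟩ := Finite.exists_max r
  refine ⟨r i₀, K, (hr _).1.le, (hr _).2, fun n x => ?_⟩
  have hK0 : |t (x n).1 (x n).2| ≤ K := hK ⟨x n, rfl⟩
  rw [norm_mul, norm_prod]
  gcongr
  · exact pow_nonneg (hr _).1.le n
  · calc ∏ j ∈ Finset.range n, ‖r (x j).1‖ ≤ ∏ _j ∈ Finset.range n, r i₀ := by
          gcongr with j _
          rw [Real.norm_of_nonneg (hr _).1.le]
          exact hi₀ _
      _ = r i₀ ^ n := by simp
  · exact hK0

theorem summable_coding (hr : ∀ i, r i ∈ Set.Ioo (0 : ℝ) 1) (t : (i : I) → Fin (k i) → ℝ)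
    (ω : ℕ → I) (u : (n : ℕ) → Fin (k (ω n))) :
    Summable fun n : ℕ => (∏ j ∈ Finset.range n, r (ω j)) * t (ω n) (u n) := by
  obtain ⟨ρ, K, h0, h1, h⟩ := exists_coding_bound hr t
  exact Summable.of_norm_bounded ((summable_geometric_of_lt_one h0 h1).mul_right K)
    fun n => h n fun n => ⟨ω n, u n⟩

theorem continuous_codeSeq (hr : ∀ i, r i ∈ Set.Ioo (0 : ℝ) 1) (t : (i : I) → Fin (k i) → ℝ) :
    Continuous (codeSeq k r t) := by
  obtain ⟨ρ, K, h0, h1, h⟩ := exists_coding_bound hr t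
  refine continuous_tsum (fun n => ?_) ((summable_geometric_of_lt_one h0 h1).mul_right K) h
  have hr' : Continuous fun a : Σ i, Fin (k i) => r a.1 := continuous_of_discreteTopology
  have ht : Continuous fun a : Σ i, Fin (k i) => t a.1 a.2 := continuous_of_discreteTopology
  exact (continuous_finsetProd _ fun j _ => hr'.comp (continuous_apply j)).mul
    (ht.comp (continuous_apply n))

theorem coding_eq_add (hr : ∀ i, r i ∈ Set.Ioo (0 : ℝ) 1) (t : (i : I) → Fin (k i) → ℝ)
    (ω : ℕ → I) (u : (n : ℕ) → Fin (k (ω n))) :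
    coding k r t ω u
      = r (ω 0) * coding k r t (shiftSeq ω) (fun n => u (n + 1)) + t (ω 0) (u 0) := by
  unfold coding
  rw [(summable_coding hr t ω u).tsum_eq_zero_add, ← tsum_mul_left, add_comm]
  congr 1
  · refine tsum_congr fun n => ?_
    rw [Finset.prod_range_succ']
    simp only [shiftSeq]
    ring
  · simp

theorem continuous_redigit : Continuous fun z : (ℕ → Σ i, Fin (k i)) × (ℕ → (i : I) → Fin (k i)) =>
    redigit z.1 z.2 := by
  refine continuous_pi fun n => ?_
  have : Continuous fun a : (Σ i, Fin (k i)) × ((i : I) → Fin (k i)) =>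
      (⟨a.1.1, a.2 a.1.1⟩ : Σ i, Fin (k i)) := continuous_of_discreteTopology
  exact this.comp (f := fun z : (ℕ → Σ i, Fin (k i)) × (ℕ → (i : I) → Fin (k i)) => (z.1 n, z.2 n))
    (by fun_prop)

theorem continuous_magnify (hr : ∀ i, r i ∈ Set.Ioo (0 : ℝ) 1) (t : (i : I) → Fin (k i) → ℝ) :
    Continuous fun z : ((ℕ → Σ i, Fin (k i)) × ℝ) × (ℕ → (i : I) → Fin (k i)) =>
      magnify k r t z.1.1 z.1.2 z.2 := by
  have h1 := continuous_codeSeq hr t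
  have h2 : Continuous fun z : ((ℕ → Σ i, Fin (k i)) × ℝ) × (ℕ → (i : I) → Fin (k i)) =>
      redigit z.1.1 z.2 := continuous_redigit.comp
        (f := fun z : ((ℕ → Σ i, Fin (k i)) × ℝ) × (ℕ → (i : I) → Fin (k i)) => (z.1.1, z.2))
        (by fun_prop)
  unfold magnify
  fun_prop

theorem measurable_magnify (hr : ∀ i, r i ∈ Set.Ioo (0 : ℝ) 1) (t : (i : I) → Fin (k i) → ℝ)
    (x : ℕ → Σ i, Fin (k i)) (τ : ℝ) : Measurable (magnify k r t x τ) :=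
  ((continuous_magnify hr t).comp (f := fun θ : ℕ → (i : I) → Fin (k i) => ((x, τ), θ))
    (by fun_prop)).measurable

end Coding

section Scenery

variable {I : Type*} [Fintype I] {k : I → ℕ} {r : I → ℝ} {π : (i : I) → Measure (Fin (k i))}
  [∀ i, IsProbabilityMeasure (π i)]

theorem choiceLaw_pos_of_isOpen (hπ : ∀ i j, π i {j} ≠ 0) {U : Set (ℕ → (i : I) → Fin (k i))}
    (hU : IsOpen U) {θ : ℕ → (i : I) → Fin (k i)} (hθ : θ ∈ U) : choiceLaw π U ≠ 0 := by
  obtain ⟨S, V, hV, hSV⟩ := isOpen_pi_iff.1 hU θ hθ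
  have hne : choiceLaw π (Set.pi S V) ≠ 0 := by
    rw [choiceLaw, Measure.infinitePi_pi _ fun _ _ => (Set.toFinite _).measurableSet,
      Finset.prod_ne_zero_iff]
    intro n hn h0
    have h1 : Measure.pi π {θ n} = 0 :=
      measure_mono_null (Set.singleton_subset_iff.2 (hV n hn).2) h0
    rw [Measure.pi_singleton, Finset.prod_eq_zero_iff] at h1
    obtain ⟨i, -, hi⟩ := h1
    exact hπ _ _ hi
  exact fun h0 => hne (measure_mono_null hSV h0)

theorem map_magnify_Icc_ne_zero (hr : ∀ i, r i ∈ Set.Ioo (0 : ℝ) 1)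
    (t : (i : I) → Fin (k i) → ℝ) (hπ : ∀ i j, π i {j} ≠ 0) (x : ℕ → Σ i, Fin (k i)) (τ : ℝ) :
    (choiceLaw π).map (magnify k r t x τ) (Set.Icc (-1) 1) ≠ 0 := by
  classical
  rw [Measure.map_apply (measurable_magnify hr t x τ) measurableSet_Icc]
  have hne : ∀ i, Nonempty (Fin (k i)) := fun i =>
    (isEmpty_or_nonempty (Fin (k i))).resolve_left fun h => by
      have := measure_univ (μ := π i)
      rw [Measure.eq_zero_of_isEmpty (π i)] at this
      simp at this
  let θ : ℕ → (i : I) → Fin (k i) := fun n =>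
    Function.update (fun i => (hne i).some) (x n).1 (x n).2
  have hθ : redigit x θ = x := by
    funext n
    simp [redigit, θ]
  have hU : IsOpen (magnify k r t x τ ⁻¹' Set.Ioo (-1) 1) :=
    isOpen_Ioo.preimage ((continuous_magnify hr t).comp
      (f := fun θ : ℕ → (i : I) → Fin (k i) => ((x, τ), θ)) (by fun_prop))
  have hmem : θ ∈ magnify k r t x τ ⁻¹' Set.Ioo (-1) 1 := by
    simp [magnify, hθ]
  exact fun h0 => choiceLaw_pos_of_isOpen hπ hU hmem
    (measure_mono_null (Set.preimage_mono Set.Ioo_subset_Icc_self) h0)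

theorem coe_choiceScenery (hr : ∀ i, r i ∈ Set.Ioo (0 : ℝ) 1)
    (t : (i : I) → Fin (k i) → ℝ) (hπ : ∀ i j, π i {j} ≠ 0) (x : ℕ → Σ i, Fin (k i)) (τ : ℝ) :
    (choiceScenery k r t π x τ : Measure ℝ)
      = ProbabilityTheory.cond ((choiceLaw π).map (magnify k r t x τ)) (Set.Icc (-1) 1) := by
  have : IsProbabilityMeasure ((choiceLaw π).map (magnify k r t x τ)) :=
    Measure.isProbabilityMeasure_map (measurable_magnify hr t x τ).aemeasurable
  have := ProbabilityTheory.cond_isProbabilityMeasure (map_magnify_Icc_ne_zero hr t hπ x τ)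
  exact congrArg Subtype.val (dif_pos this)

theorem integral_choiceScenery (hr : ∀ i, r i ∈ Set.Ioo (0 : ℝ) 1)
    (t : (i : I) → Fin (k i) → ℝ) (hπ : ∀ i j, π i {j} ≠ 0) (x : ℕ → Σ i, Fin (k i)) (τ : ℝ)
    (h : BoundedContinuousFunction ℝ ℝ) :
    ∫ y, h y ∂(choiceScenery k r t π x τ : Measure ℝ)
      = (∫ θ, (Set.Icc (-1 : ℝ) 1).indicator (1 : ℝ → ℝ) (magnify k r t x τ θ) ∂choiceLaw π)⁻¹
        * ∫ θ, (Set.Icc (-1 : ℝ) 1).indicator h (magnify k r t x τ θ) ∂choiceLaw π := by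
  have hm := measurable_magnify hr t x τ
  have aux : ∀ {g : ℝ → ℝ}, Measurable g →
      ∫ θ, (Set.Icc (-1 : ℝ) 1).indicator g (magnify k r t x τ θ) ∂choiceLaw π
        = ∫ y in Set.Icc (-1 : ℝ) 1, g y ∂(choiceLaw π).map (magnify k r t x τ) := by
    intro g hg
    rw [← integral_indicator measurableSet_Icc, integral_map hm.aemeasurable
      (hg.indicator measurableSet_Icc).aestronglyMeasurable]
  rw [coe_choiceScenery hr t hπ, ProbabilityTheory.cond, integral_smul_measure,
    aux h.continuous.measurable, aux measurable_one]
  simp [Measure.real]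

/-- The scenery is continuous in the point and the time, where no mass sits on the boundary of the
window. -/
theorem continuousAt_choiceScenery (hr : ∀ i, r i ∈ Set.Ioo (0 : ℝ) 1)
    (t : (i : I) → Fin (k i) → ℝ) (hπ : ∀ i j, π i {j} ≠ 0) {x : ℕ → Σ i, Fin (k i)} {τ : ℝ}
    (h0 : choiceLaw π {θ | |magnify k r t x τ θ| = 1} = 0) :
    ContinuousAt (fun z : (ℕ → Σ i, Fin (k i)) × ℝ => choiceScenery k r t π z.1 z.2) (x, τ) := by
  have aux : ∀ {g : ℝ → ℝ} {C : ℝ}, Continuous g → (∀ y, |g y| ≤ C) →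
      ContinuousAt (fun z : (ℕ → Σ i, Fin (k i)) × ℝ =>
        ∫ θ, (Set.Icc (-1 : ℝ) 1).indicator g (magnify k r t z.1 z.2 θ) ∂choiceLaw π) (x, τ) := by
    intro g C hg hC
    refine continuousAt_of_dominated (bound := fun _ => C)
      (Eventually.of_forall fun z => ((hg.measurable.indicator measurableSet_Icc).comp
        (measurable_magnify hr t z.1 z.2)).aestronglyMeasurable)
      (Eventually.of_forall fun z => Eventually.of_forall fun θ => ?_) (integrable_const C) ?_
    · exact (norm_indicator_le_norm_self _ _).trans (hC _)
    · have hae : ∀ᵐ θ ∂choiceLaw π, |magnify k r t x τ θ| ≠ 1 := by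
        simpa [ae_iff] using h0
      filter_upwards [hae] with θ hθ
      have hmag : ContinuousAt (fun z : (ℕ → Σ i, Fin (k i)) × ℝ => magnify k r t z.1 z.2 θ)
          (x, τ) :=
        ((continuous_magnify hr t).comp (f := fun z => (z, θ)) (by fun_prop)).continuousAt
      refine ContinuousAt.comp (g := (Set.Icc (-1 : ℝ) 1).indicator g) ?_ hmag
      refine ContinuousOn.continuousAt_indicator (hg.continuousOn) ?_
      rw [frontier_Icc (by norm_num)]
      rintro (h | h) <;> exact hθ (by rw [h]; norm_num)
  refine ProbabilityMeasure.tendsto_iff_forall_integral_tendsto.2 fun h => ?_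
  simp only [integral_choiceScenery hr t hπ]
  refine Tendsto.mul (Tendsto.inv₀ (aux (C := 1) continuous_one (by simp)) ?_)
    (aux h.continuous fun y => h.norm_coe_le_norm y)
  have hm := measurable_magnify hr t x τ
  have e : (fun θ => (Set.Icc (-1 : ℝ) 1).indicator (1 : ℝ → ℝ) (magnify k r t x τ θ))
      = (magnify k r t x τ ⁻¹' Set.Icc (-1 : ℝ) 1).indicator 1 := rfl
  rw [e, integral_indicator_one (hm measurableSet_Icc), Measure.real, ENNReal.toReal_ne_zero]
  refine ⟨?_, measure_ne_top _ _⟩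
  have := map_magnify_Icc_ne_zero hr t hπ x τ
  rwa [Measure.map_apply hm measurableSet_Icc] at this

theorem countable_magnify_boundary (hr : ∀ i, r i ∈ Set.Ioo (0 : ℝ) 1)
    (t : (i : I) → Fin (k i) → ℝ) (x : ℕ → Σ i, Fin (k i)) :
    {τ | choiceLaw π {θ | |magnify k r t x τ θ| = 1} ≠ 0}.Countable := by
  have hm : Measurable fun θ => -Real.log |magnify k r t x 0 θ| := by
    have := measurable_magnify hr t x 0
    fun_prop
  refine (Measure.countable_meas_level_set_pos (μ := choiceLaw π) hm).mono fun τ hτ => ?_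
  refine pos_iff_ne_zero.2 fun h0 => hτ (measure_mono_null (fun θ hθ => ?_) h0)
  simp only [Set.mem_ofPred_eq, magnify, abs_mul, Real.abs_exp, Real.exp_zero, one_mul] at hθ ⊢
  have : |codeSeq k r t (redigit x θ) - codeSeq k r t x| = Real.exp (-τ) := by
    rw [Real.exp_neg]; exact eq_inv_of_mul_eq_one_right hθ
  rw [this, Real.log_exp, neg_neg]

theorem exists_bound_choiceScenery (hr : ∀ i, r i ∈ Set.Ioo (0 : ℝ) 1)
    (t : (i : I) → Fin (k i) → ℝ) (hπ : ∀ i j, π i {j} ≠ 0) (f : C(ProbabilityMeasure ℝ, ℝ)) :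
    ∃ M : ℝ, ∀ x τ, |f (choiceScenery k r t π x τ)| ≤ M := by
  have hK := isCompact_setOfPred_probabilityMeasure_mass_eq_compl_isCompact_le (E := ℝ)
    (u := fun _ => 0) (K := fun _ => Set.Icc (-1) 1) tendsto_const_nhds (fun _ => isCompact_Icc)
    (Or.inl inferInstance)
  obtain ⟨M, hM⟩ := hK.exists_bound_of_continuousOn f.continuous.continuousOn
  refine ⟨M, fun x τ => hM _ fun n => ?_⟩
  have : (choiceScenery k r t π x τ : Measure ℝ) (Set.Icc (-1) 1)ᶜ = 0 := by
    rw [coe_choiceScenery hr t hπ, ProbabilityTheory.cond_apply measurableSet_Icc]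
    simp
  simp [ProbabilityMeasure.coeFn_def, this]

theorem aestronglyMeasurable_choiceScenery (hr : ∀ i, r i ∈ Set.Ioo (0 : ℝ) 1)
    (t : (i : I) → Fin (k i) → ℝ) (hπ : ∀ i j, π i {j} ≠ 0) (f : C(ProbabilityMeasure ℝ, ℝ))
    (x : ℕ → Σ i, Fin (k i)) :
    AEStronglyMeasurable (fun τ => f (choiceScenery k r t π x τ)) volume := by
  have hc := countable_magnify_boundary (π := π) hr t x
  have hs := hc.measurableSet.compl
  rw [← Measure.restrict_eq_self_of_ae_mem (s := {τ | _}ᶜ) (hc.ae_notMem volume)]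
  refine ContinuousOn.aestronglyMeasurable (fun τ hτ => ?_) hs
  refine (f.continuous.continuousAt.comp ?_).continuousWithinAt
  exact ContinuousAt.comp (f := fun τ => (x, τ))
    (continuousAt_choiceScenery hr t hπ (not_not.1 hτ)) (by fun_prop)

theorem continuous_integral_choiceScenery (hr : ∀ i, r i ∈ Set.Ioo (0 : ℝ) 1)
    (t : (i : I) → Fin (k i) → ℝ) (hπ : ∀ i j, π i {j} ≠ 0) (f : C(ProbabilityMeasure ℝ, ℝ))
    (l : I → ℝ) :
    Continuous fun x : ℕ → Σ i, Fin (k i) =>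
      ∫ τ in (0 : ℝ)..l (x 0).1, f (choiceScenery k r t π x τ) := by
  obtain ⟨M, hM⟩ := exists_bound_choiceScenery hr t hπ f
  refine continuous_iff_continuousAt.2 fun x₀ => ?_
  have h : ContinuousAt (fun x : ℕ → Σ i, Fin (k i) =>
      ∫ τ in (0 : ℝ)..l (x₀ 0).1, f (choiceScenery k r t π x τ)) x₀ := by
    refine intervalIntegral.continuousAt_of_dominated_interval (bound := fun _ => M)
      (Eventually.of_forall fun x =>
        (aestronglyMeasurable_choiceScenery hr t hπ f x).restrict)
      (Eventually.of_forall fun x => Eventually.of_forall fun τ _ => hM x τ)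
      intervalIntegrable_const ?_
    filter_upwards [(countable_magnify_boundary (π := π) hr t x₀).ae_notMem volume] with τ hτ _
    refine f.continuous.continuousAt.comp ?_
    exact ContinuousAt.comp (f := fun x => (x, τ))
      (continuousAt_choiceScenery hr t hπ (not_not.1 hτ)) (by fun_prop)
  refine h.congr ?_
  have : ∀ᶠ x in 𝓝 x₀, x 0 = x₀ 0 :=
    (continuous_apply 0).continuousAt.eventually (isOpen_discrete {x₀ 0} |>.mem_nhds rfl)
  filter_upwards [this] with x hx
  rw [hx]

end Scenery

/-- The measure with given point masses on a finite type. -/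
def weightMeasure {α : Type*} [Fintype α] [MeasurableSpace α] (w : α → ℝ) : Measure α :=
  ∑ a, ENNReal.ofReal (w a) • Measure.dirac a

theorem weightMeasure_singleton {α : Type*} [Fintype α] [MeasurableSpace α]
    [MeasurableSingletonClass α] (w : α → ℝ) (a : α) :
    weightMeasure w {a} = ENNReal.ofReal (w a) := by
  classical
  simp [weightMeasure, Measure.finsetSum_apply, Set.indicator_apply]

theorem isProbabilityMeasure_weightMeasure {α : Type*} [Fintype α] [MeasurableSpace α]
    {w : α → ℝ} (hw : ∀ a, 0 ≤ w a) (hw1 : ∑ a, w a = 1) :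
    IsProbabilityMeasure (weightMeasure w) :=
  ⟨by simp [weightMeasure, Measure.finsetSum_apply, ← ENNReal.ofReal_sum_of_nonneg, hw, hw1]⟩

theorem scaleM_recenter {η : Measure ℝ} [IsProbabilityMeasure η] {a τ : ℝ} (hτ : 0 ≤ τ)
    (h0 : η.map (fun y => Real.exp τ * (y - a)) (Set.Icc (-1) 1) ≠ 0) :
    scaleM τ (recenter η a)
      = ProbabilityTheory.cond (η.map fun y => Real.exp τ * (y - a)) (Set.Icc (-1) 1) := by
  have hexp : Real.exp τ * Real.exp (-τ) = 1 := by rw [← Real.exp_add]; simp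
  have hle : Real.exp (-τ) ≤ 1 := by simpa using hτ
  have hpos := Real.exp_pos τ
  have hball : ∀ y : ℝ, Real.exp τ * y ∈ Set.Icc (-1 : ℝ) 1
      ↔ y ∈ Set.Icc (-Real.exp (-τ)) (Real.exp (-τ)) := by
    intro y
    rw [Set.mem_Icc, Set.mem_Icc, ← abs_le, ← abs_le, abs_mul, Real.abs_exp, ← hexp,
      mul_le_mul_iff_right₀ hpos]
  set μ := η.map fun y => y - a
  have hm : Measurable fun y : ℝ => Real.exp τ * y := by fun_prop
  have hcomp : (η.map fun y => Real.exp τ * (y - a)) = μ.map fun y => Real.exp τ * y := by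
    rw [Measure.map_map hm (by fun_prop)]; rfl
  rw [hcomp] at h0 ⊢
  set c := η (Set.Icc (a - 1) (a + 1))
  have hcμ : c = μ (Set.Icc (-1) 1) := by
    have e : (fun y => y - a) ⁻¹' Set.Icc (-1) 1 = Set.Icc (a - 1) (a + 1) := by
      ext y
      simp only [Set.mem_Icc, Set.mem_preimage]
      constructor <;> rintro ⟨h1, h2⟩ <;> constructor <;> linarith
    rw [Measure.map_apply (by fun_prop) measurableSet_Icc, e]
  have hsub : (fun y => Real.exp τ * y) ⁻¹' Set.Icc (-1) 1 ⊆ Set.Icc (-1 : ℝ) 1 := by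
    intro y hy
    have := (hball y).1 hy
    exact ⟨by linarith [this.1], by linarith [this.2]⟩
  have hc0 : c ≠ 0 := by
    rw [Measure.map_apply hm measurableSet_Icc] at h0
    rw [hcμ]
    exact fun h => h0 (measure_mono_null hsub h)
  have hctop : c ≠ ⊤ := measure_ne_top _ _
  have hrec : ∀ E, MeasurableSet E → E ⊆ Set.Icc (-1 : ℝ) 1 → recenter η a E = c⁻¹ * μ E := by
    intro E hE hEs
    change (c⁻¹ • μ.restrict (Set.Icc (-1) 1)) E = _
    rw [Measure.smul_apply, Measure.restrict_apply hE, Set.inter_eq_left.2 hEs, smul_eq_mul]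
  have hpre : (fun y => Real.exp τ * y) ⁻¹' Set.Icc (-1) 1
      = Set.Icc (-Real.exp (-τ)) (Real.exp (-τ)) := Set.ext hball
  ext E hE
  have hIE := measurableSet_Icc.inter hE (s₁ := Set.Icc (-1 : ℝ) 1)
  rw [scaleM, Measure.smul_apply, Measure.restrict_apply hE, Set.inter_comm,
    Measure.map_apply hm hIE, ← hpre, hrec _ (hm measurableSet_Icc) hsub,
    hrec _ (hm hIE) ((Set.preimage_mono Set.inter_subset_left).trans hsub), smul_eq_mul,
    ProbabilityTheory.cond_apply measurableSet_Icc, Measure.map_apply hm measurableSet_Icc,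
    Measure.map_apply hm hIE, ENNReal.mul_inv (by simp [hctop]) (by simp [hc0]), inv_inv,
    mul_mul_mul_comm, ENNReal.mul_inv_cancel hc0 hctop, one_mul]

instance {I : Type*} {k : I → ℕ} : DiscreteMeasurableSpace (Σ i, Fin (k i)) :=
  ⟨fun _ => MeasurableSpace.measurableSet_iInf.2 fun _ =>
    MeasurableSpace.map_def.2 .of_discrete⟩

section Shift

variable {I : Type*} [Fintype I] {k : I → ℕ} {r : I → ℝ} {π : (i : I) → Measure (Fin (k i))}
  [∀ i, IsProbabilityMeasure (π i)]

theorem pi_setOf_apply_eq (i : I) (a : Fin (k i)) :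
    Measure.pi π {g | g i = a} = π i {a} :=
  (measurePreserving_eval π i).measure_preimage (measurableSet_singleton a).nullMeasurableSet

theorem choiceLaw_cylinder (ω : ℕ → I) (n : ℕ) (c : (j : ℕ) → Fin (k (ω j))) :
    choiceLaw π {θ | ∀ j < n, θ j (ω j) = c j} = ∏ j ∈ Finset.range n, π (ω j) {c j} := by
  have e : {θ : ℕ → (i : I) → Fin (k i) | ∀ j < n, θ j (ω j) = c j}
      = Set.pi (Finset.range n) fun j => {g | g (ω j) = c j} := by
    ext θ; simp [Set.mem_pi]
  rw [e, choiceLaw, Measure.infinitePi_pi _ fun _ _ => (Set.toFinite _).measurableSet]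
  simp only [pi_setOf_apply_eq]

theorem choiceLaw_inter_shift (i : I) (a : Fin (k i)) {A : Set (ℕ → (i : I) → Fin (k i))}
    (hA : MeasurableSet A) :
    choiceLaw π ({θ | θ 0 i = a} ∩ shiftSeq ⁻¹' A) = π i {a} * choiceLaw π A := by
  have hs : Measurable (shiftSeq : (ℕ → (i : I) → Fin (k i)) → _) :=
    measurable_pi_lambda _ fun n => measurable_pi_apply (n + 1)
  suffices h : ((choiceLaw π).restrict {θ | θ 0 i = a}).map shiftSeq = π i {a} • choiceLaw π by
    rw [Set.inter_comm, ← Measure.restrict_apply (hs hA), ← Measure.map_apply hs hA, h]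
    rfl
  refine ext_of_cylinder fun n c => ?_
  have hcyl : {θ : ℕ → (i : I) → Fin (k i) | ∀ j < n, θ j = c j}
      = Set.pi (Finset.range n) fun j => {c j} := by
    ext θ; simp [Set.mem_pi]
  have hcylm : MeasurableSet {θ : ℕ → (i : I) → Fin (k i) | ∀ j < n, θ j = c j} := by
    rw [hcyl]
    exact .pi (Finset.countable_toSet _) fun j _ => measurableSet_singleton _
  let V : ℕ → Set ((i : I) → Fin (k i)) := fun
    | 0 => {g | g i = a}
    | j + 1 => {c j}
  have e : shiftSeq ⁻¹' {θ : ℕ → (i : I) → Fin (k i) | ∀ j < n, θ j = c j} ∩ {θ | θ 0 i = a}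
      = Set.pi (Finset.range (n + 1)) V := by
    ext θ
    simp only [Set.mem_inter_iff, Set.mem_preimage, Set.mem_ofPred_eq, Set.mem_pi,
      Finset.coe_range, Set.mem_Iio, shiftSeq]
    refine ⟨fun ⟨h1, h2⟩ j hj => ?_, fun h => ⟨fun j hj => h (j + 1) (by lia), h 0 (by lia)⟩⟩
    cases j with
    | zero => exact h2
    | succ j => exact h1 j (by lia)
  have hV : ∀ j, MeasurableSet (V j) := fun j => (Set.toFinite (V j)).measurableSet
  rw [Measure.map_apply hs hcylm, Measure.restrict_apply (hs hcylm), e, Measure.smul_apply, hcyl,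
    choiceLaw, Measure.infinitePi_pi _ fun j _ => hV j,
    Measure.infinitePi_pi _ fun j _ => measurableSet_singleton (c j), Finset.prod_range_succ',
    mul_comm]
  simp only [V, pi_setOf_apply_eq, smul_eq_mul]

theorem codeSeq_eq_add (hr : ∀ i, r i ∈ Set.Ioo (0 : ℝ) 1) (t : (i : I) → Fin (k i) → ℝ)
    (x : ℕ → Σ i, Fin (k i)) :
    codeSeq k r t x = r (x 0).1 * codeSeq k r t (shiftSeq x) + t (x 0).1 (x 0).2 :=
  coding_eq_add hr t _ _

/-- The scenery at time `-log r_{ω_1}` is the scenery of the shifted point at time `0`. -/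
theorem choiceScenery_shift (hr : ∀ i, r i ∈ Set.Ioo (0 : ℝ) 1) (t : (i : I) → Fin (k i) → ℝ)
    (hπ : ∀ i j, π i {j} ≠ 0)
    (hsep : ∀ (x : ℕ → Σ i, Fin (k i)) (θ : ℕ → (i : I) → Fin (k i)), θ 0 (x 0).1 ≠ (x 0).2 →
      2 < |codeSeq k r t (redigit x θ) - codeSeq k r t x|)
    (x : ℕ → Σ i, Fin (k i)) {s : ℝ} (hs : 0 ≤ s) :
    choiceScenery k r t π x (-Real.log (r (x 0).1) + s)
      = choiceScenery k r t π (shiftSeq x) s := by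
  set τ := -Real.log (r (x 0).1) + s
  have hr0 := (hr (x 0).1).1
  have hτ : Real.exp τ = (r (x 0).1)⁻¹ * Real.exp s := by
    rw [Real.exp_add, Real.exp_neg, Real.exp_log hr0]
  have hτ1 : 1 ≤ Real.exp τ := by
    have := Real.log_nonpos hr0.le (hr (x 0).1).2.le
    exact Real.one_le_exp (by simp only [τ]; linarith)
  have hm := measurable_magnify hr t x τ
  have hm' := measurable_magnify hr t (shiftSeq x) s
  set c := π (x 0).1 {(x 0).2}
  have key : ∀ E : Set ℝ, MeasurableSet E → E ⊆ Set.Icc (-1) 1 →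
      (choiceLaw π).map (magnify k r t x τ) E
        = c * (choiceLaw π).map (magnify k r t (shiftSeq x) s) E := by
    intro E hE hEs
    rw [Measure.map_apply hm hE, Measure.map_apply hm' hE, ← choiceLaw_inter_shift _ _ (hm' hE)]
    congr 1
    have haux : ∀ θ, θ 0 (x 0).1 = (x 0).2 →
        magnify k r t x τ θ = magnify k r t (shiftSeq x) s (shiftSeq θ) := by
      intro θ hθ
      have e : codeSeq k r t (redigit x θ)
          = r (x 0).1 * codeSeq k r t (redigit (shiftSeq x) (shiftSeq θ))
            + t (x 0).1 (x 0).2 := by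
        rw [← hθ]; exact codeSeq_eq_add hr t _
      rw [magnify, magnify, e, codeSeq_eq_add hr t x, hτ]
      field_simp
      ring
    ext θ
    simp only [Set.mem_preimage, Set.mem_inter_iff, Set.mem_ofPred_eq]
    constructor
    · intro h
      have hθ : θ 0 (x 0).1 = (x 0).2 := by
        by_contra hne
        have h2 := hsep x θ hne
        have h1 := abs_le.2 (hEs h)
        rw [magnify, abs_mul, Real.abs_exp] at h1
        nlinarith
      exact ⟨hθ, haux θ hθ ▸ h⟩
    · rintro ⟨hθ, h⟩
      rwa [haux θ hθ]
  have hc0 : c ≠ 0 := hπ _ _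
  have hctop : c ≠ ⊤ := measure_ne_top _ _
  unfold choiceScenery
  congr 1
  ext E hE
  rw [ProbabilityTheory.cond_apply measurableSet_Icc, ProbabilityTheory.cond_apply measurableSet_Icc,
    key _ measurableSet_Icc subset_rfl, key _ (measurableSet_Icc.inter hE) Set.inter_subset_left,
    ENNReal.mul_inv (by simp [hc0]) (by simp [hctop]), mul_mul_mul_comm,
    ENNReal.inv_mul_cancel hc0 hctop, one_mul]

theorem choiceScenery_add (hr : ∀ i, r i ∈ Set.Ioo (0 : ℝ) 1) (t : (i : I) → Fin (k i) → ℝ)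
    (hπ : ∀ i j, π i {j} ≠ 0)
    (hsep : ∀ (x : ℕ → Σ i, Fin (k i)) (θ : ℕ → (i : I) → Fin (k i)), θ 0 (x 0).1 ≠ (x 0).2 →
      2 < |codeSeq k r t (redigit x θ) - codeSeq k r t x|)
    (x : ℕ → Σ i, Fin (k i)) (m : ℕ) {s : ℝ} (hs : 0 ≤ s) :
    choiceScenery k r t π x ((∑ j ∈ Finset.range m, -Real.log (r (x j).1)) + s)
      = choiceScenery k r t π (fun j => x (m + j)) s := by
  induction m generalizing s with
  | zero => simp
  | succ m ih =>
    have := Real.log_nonpos (hr (x m).1).1.le (hr (x m).1).2.le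
    rw [Finset.sum_range_succ, add_assoc, ih (by linarith)]
    refine (choiceScenery_shift hr t hπ hsep (fun j => x (m + j)) hs).trans ?_
    congr 1
    funext j
    simp only [shiftSeq]
    congr 1
    ring

theorem intervalIntegrable_choiceScenery (hr : ∀ i, r i ∈ Set.Ioo (0 : ℝ) 1)
    (t : (i : I) → Fin (k i) → ℝ) (hπ : ∀ i j, π i {j} ≠ 0) (f : C(ProbabilityMeasure ℝ, ℝ))
    (x : ℕ → Σ i, Fin (k i)) (a b : ℝ) :
    IntervalIntegrable (fun τ => f (choiceScenery k r t π x τ)) volume a b := by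
  obtain ⟨M, hM⟩ := exists_bound_choiceScenery hr t hπ f
  exact (intervalIntegrable_const (c := M)).mono_fun'
    (aestronglyMeasurable_choiceScenery hr t hπ f x).restrict (Eventually.of_forall fun τ => hM x τ)

/-- Time averages along the scenery of a generic point. -/
theorem tendsto_time_average_choiceScenery (hr : ∀ i, r i ∈ Set.Ioo (0 : ℝ) 1)
    (t : (i : I) → Fin (k i) → ℝ) (hπ : ∀ i j, π i {j} ≠ 0)
    (hsep : ∀ (x : ℕ → Σ i, Fin (k i)) (θ : ℕ → (i : I) → Fin (k i)), θ 0 (x 0).1 ≠ (x 0).2 →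
      2 < |codeSeq k r t (redigit x θ) - codeSeq k r t x|)
    {B : Measure (ℕ → Σ i, Fin (k i))} [IsProbabilityMeasure B] {x : ℕ → Σ i, Fin (k i)}
    (hx : ∀ G : (ℕ → Σ i, Fin (k i)) → ℝ, Continuous G →
      Tendsto (fun N : ℕ => (∑ m ∈ Finset.range N, G fun j => x (m + j)) / N) atTop
        (𝓝 (∫ y, G y ∂B)))
    (f : C(ProbabilityMeasure ℝ, ℝ)) :
    Tendsto (fun T : ℝ => T⁻¹ * ∫ τ in (0 : ℝ)..T, f (choiceScenery k r t π x τ)) atTop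
      (𝓝 ((∫ y, -Real.log (r (y 0).1) ∂B)⁻¹ *
        ∫ y, (∫ τ in (0 : ℝ)..-Real.log (r (y 0).1), f (choiceScenery k r t π y τ)) ∂B)) := by
  have hlog : ∀ i, 0 < -Real.log (r i) := fun i => neg_pos.2 (Real.log_neg (hr i).1 (hr i).2)
  have hL : Continuous fun y : ℕ → Σ i, Fin (k i) => -Real.log (r (y 0).1) := by
    have : Continuous fun a : Σ i, Fin (k i) => -Real.log (r a.1) := continuous_of_discreteTopology
    exact this.comp (continuous_apply 0)
  have hpos : 0 < ∫ y, -Real.log (r (y 0).1) ∂B := by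
    obtain ⟨i₀, hi₀⟩ := have : Nonempty I := ⟨(x 0).1⟩
      Finite.exists_min fun i => -Real.log (r i)
    obtain ⟨i₁, hi₁⟩ := have : Nonempty I := ⟨(x 0).1⟩
      Finite.exists_max fun i => -Real.log (r i)
    have hmeas : Measurable fun y : ℕ → Σ i, Fin (k i) => -Real.log (r (y 0).1) := by
      exact (measurable_of_finite fun a : Σ i, Fin (k i) => -Real.log (r a.1)).comp
        (measurable_pi_apply 0)
    have hint : Integrable (fun y : ℕ → Σ i, Fin (k i) => -Real.log (r (y 0).1)) B :=
      Integrable.of_bound hmeas.aestronglyMeasurable (-Real.log (r i₁))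
        (Eventually.of_forall fun y => by
          rw [Real.norm_of_nonneg (hlog _).le]; exact hi₁ _)
    have := integral_mono (μ := B) (integrable_const (-Real.log (r i₀))) hint fun y => hi₀ _
    simp only [integral_const, probReal_univ, one_smul] at this
    exact (hlog i₀).trans_le this
  obtain ⟨M, hM⟩ := exists_bound_choiceScenery hr t hπ f
  have hii := intervalIntegrable_choiceScenery hr t hπ f
  refine tendsto_time_average (M := M) (S := fun m => ∑ j ∈ Finset.range m, -Real.log (r (x j).1))
    (hM x) (hii x) hpos (by simpa using hx _ hL) ?_
  refine (hx _ (continuous_integral_choiceScenery hr t hπ f fun i => -Real.log (r i))).congr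
    fun N => ?_
  congr 1
  induction N with
  | zero => simp
  | succ N ih =>
    set S := ∑ j ∈ Finset.range N, -Real.log (r (x j).1)
    have e : ∫ τ in (0 : ℝ)..-Real.log (r (x N).1), f (choiceScenery k r t π x (S + τ))
        = ∫ τ in S..S + -Real.log (r (x N).1), f (choiceScenery k r t π x τ) := by
      simpa using intervalIntegral.integral_comp_add_left (a := 0) (b := -Real.log (r (x N).1))
        (fun τ => f (choiceScenery k r t π x τ)) S
    rw [Finset.sum_range_succ, ih, Finset.sum_range_succ,
      ← intervalIntegral.integral_add_adjacent_intervals (hii x 0 S)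
        (hii x S (S + -Real.log (r (x N).1))), ← e]
    congr 1
    simp only [add_zero]
    refine intervalIntegral.integral_congr fun τ hτ => ?_
    rw [Set.uIcc_of_le (hlog _).le] at hτ
    exact congrArg f (choiceScenery_add hr t hπ hsep x N hτ.1).symm

theorem scenery_eq_choiceScenery (hr : ∀ i, r i ∈ Set.Ioo (0 : ℝ) 1)
    (t : (i : I) → Fin (k i) → ℝ) (hπ : ∀ i j, π i {j} ≠ 0)
    {η' : (ω : ℕ → I) → Measure ((n : ℕ) → Fin (k (ω n)))}
    (hη' : ∀ ω, η' ω = (choiceLaw π).map fun θ n => θ n (ω n))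
    (ω : ℕ → I) (u : (n : ℕ) → Fin (k (ω n))) {τ : ℝ} (hτ : 0 ≤ τ) :
    scenery k r t η' ω u τ = choiceScenery k r t π (fun n => ⟨ω n, u n⟩) τ := by
  set x : ℕ → Σ i, Fin (k i) := fun n => ⟨ω n, u n⟩
  have hcode : Measurable (coding k r t ω) := by
    have h : Continuous fun (v : (n : ℕ) → Fin (k (ω n))) (n : ℕ) =>
        (⟨ω n, v n⟩ : Σ i, Fin (k i)) :=
      continuous_pi fun n => continuous_sigmaMk.comp (continuous_apply n)
    exact ((continuous_codeSeq hr t).comp h).measurable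
  have hsel : Measurable fun (θ : ℕ → (i : I) → Fin (k i)) n => θ n (ω n) := by fun_prop
  have heta : etaMeas k r t η' ω
      = (choiceLaw π).map fun θ => codeSeq k r t (redigit x θ) := by
    rw [etaMeas, hη', Measure.map_map hcode hsel]; rfl
  have hm : Measurable fun θ => codeSeq k r t (redigit x θ) := hcode.comp hsel
  have hmap : (etaMeas k r t η' ω).map (fun y => Real.exp τ * (y - coding k r t ω u))
      = (choiceLaw π).map (magnify k r t x τ) := by
    rw [heta, Measure.map_map (by fun_prop) hm]; rfl
  have : IsProbabilityMeasure (etaMeas k r t η' ω) := by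
    rw [heta]; exact Measure.isProbabilityMeasure_map hm.aemeasurable
  rw [scenery, scaleM_recenter hτ, hmap, choiceScenery]
  rw [hmap]
  exact map_magnify_Icc_ne_zero hr t hπ x τ

end Shift

theorem map_choiceLaw_prod {I : Type*} [Fintype I] [MeasurableSpace I] [MeasurableSingletonClass I]
    {k : I → ℕ} {π : (i : I) → Measure (Fin (k i))} [∀ i, IsProbabilityMeasure (π i)]
    {w : I → ENNReal} {P : Measure (ℕ → I)} [IsProbabilityMeasure P]
    (hP : ∀ (n : ℕ) (c : ℕ → I), P {ω | ∀ j < n, ω j = c j} = ∏ j ∈ Finset.range n, w (c j))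
    {β : Measure (Σ i, Fin (k i))} [IsProbabilityMeasure β]
    (hβ : ∀ a, β {a} = w a.1 * π a.1 {a.2}) :
    (P.prod (choiceLaw π)).map (fun z n => (⟨z.1 n, z.2 n (z.1 n)⟩ : Σ i, Fin (k i)))
      = Measure.infinitePi fun _ : ℕ => β := by
  have hpair : Measurable fun z : I × ((i : I) → Fin (k i)) =>
      (⟨z.1, z.2 z.1⟩ : Σ i, Fin (k i)) := .of_discrete
  have hΨ : Measurable fun (z : (ℕ → I) × (ℕ → (i : I) → Fin (k i))) (n : ℕ) =>
      (⟨z.1 n, z.2 n (z.1 n)⟩ : Σ i, Fin (k i)) :=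
    measurable_pi_lambda _ fun n => hpair.comp (by fun_prop : Measurable
      fun z : (ℕ → I) × (ℕ → (i : I) → Fin (k i)) => (z.1 n, z.2 n))
  have := Measure.isProbabilityMeasure_map (μ := P.prod (choiceLaw π)) hΨ.aemeasurable
  refine ext_of_cylinder fun n c => ?_
  have hcyl : {x : ℕ → Σ i, Fin (k i) | ∀ j < n, x j = c j}
      = Set.pi (Finset.range n) fun j => {c j} := by
    ext x; simp [Set.mem_pi]
  have hcylm : MeasurableSet {x : ℕ → Σ i, Fin (k i) | ∀ j < n, x j = c j} := by
    rw [hcyl]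
    exact .pi (Finset.countable_toSet _) fun j _ => measurableSet_singleton _
  have hrect : (fun (z : (ℕ → I) × (ℕ → (i : I) → Fin (k i))) (n : ℕ) =>
      (⟨z.1 n, z.2 n (z.1 n)⟩ : Σ i, Fin (k i))) ⁻¹' {x | ∀ j < n, x j = c j}
      = {ω | ∀ j < n, ω j = (c j).1} ×ˢ {θ | ∀ j < n, θ j (c j).1 = (c j).2} := by
    have haux : ∀ (i : I) (g : (i : I) → Fin (k i)) (b : Σ i, Fin (k i)),
        (⟨i, g i⟩ : Σ i, Fin (k i)) = b ↔ i = b.1 ∧ g b.1 = b.2 := by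
      rintro i g ⟨i', b⟩
      constructor
      · rintro h
        cases h
        exact ⟨rfl, rfl⟩
      · rintro ⟨rfl, h⟩
        exact congrArg (Sigma.mk i) h
    ext z
    simp only [Set.mem_preimage, Set.mem_ofPred_eq, Set.mem_prod, haux]
    exact ⟨fun h => ⟨fun j hj => (h j hj).1, fun j hj => (h j hj).2⟩,
      fun h j hj => ⟨h.1 j hj, h.2 j hj⟩⟩
  rw [Measure.map_apply hΨ hcylm, hrect, Measure.prod_prod, hP n fun j => (c j).1,
    choiceLaw_cylinder (fun j => (c j).1) n fun j => (c j).2, hcyl,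
    Measure.infinitePi_pi _ fun j _ => measurableSet_singleton (c j), ← Finset.prod_mul_distrib]
  simp only [hβ]

theorem two_lt_abs_codeSeq_redigit_sub {I : Type*} [Fintype I] {k : I → ℕ} {r : I → ℝ}
    (hr : ∀ i, r i ∈ Set.Ioo (0 : ℝ) 1) (t : (i : I) → Fin (k i) → ℝ)
    (hsep : ∀ ω : ℕ → I, ∀ u v : Fin (k (ω 0)), u ≠ v →
      ∀ x ∈ (fun x => r (ω 0) * x + t (ω 0) u) '' Yset k r t (shiftSeq ω),
      ∀ y ∈ (fun x => r (ω 0) * x + t (ω 0) v) '' Yset k r t (shiftSeq ω), 2 < |x - y|)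
    (x : ℕ → Σ i, Fin (k i)) (θ : ℕ → (i : I) → Fin (k i)) (hθ : θ 0 (x 0).1 ≠ (x 0).2) :
    2 < |codeSeq k r t (redigit x θ) - codeSeq k r t x| :=
  hsep (fun n => (x n).1) _ _ hθ _ ⟨_, ⟨_, rfl⟩, (codeSeq_eq_add hr t (redigit x θ)).symm⟩
    _ ⟨_, ⟨_, rfl⟩, (codeSeq_eq_add hr t x).symm⟩

/-- for a Bernoulli, orientation-preserving model with strong separation
whose pieces are at mutual distance `> 2`: for `ℙ`-a.e. `ω` and `η̄^{(ω)}`-a.e. `u`, the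
scenery of `η^{(ω)}` at `Π_ω(u)` equidistributes for the distribution `Q`, the push-forward
of the normalized suspension measure `Q̄` under `(ω,u,τ) ↦ S_τ η_{ω,u}`; i.e. for every
continuous `f` on probability measures (weak topology), the time averages of
`f(S_τ η_{ω,u})` converge to `∫ f dQ`, written below as the explicit integral of `f` over
the suspension. -/
theorem stmt12
    (I : Type) [Fintype I] [Nonempty I] [MeasurableSpace I] [MeasurableSingletonClass I]
    (k : I → ℕ) (hk : ∀ i, 0 < k i)
    (r : I → ℝ) (hr : ∀ i, r i ∈ Set.Ioo (0 : ℝ) 1)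
    (t : (i : I) → Fin (k i) → ℝ)
    (p : (i : I) → Fin (k i) → ℝ) (hp : ∀ i j, 0 < p i j) (hpsum : ∀ i, ∑ j, p i j = 1)
    (q : I → ℝ) (hq : ∀ i, 0 < q i) (hqsum : ∑ i, q i = 1)
    (P : Measure (ℕ → I)) (hP : IsProbabilityMeasure P)
    (hPcyl : ∀ (n : ℕ) (c : ℕ → I),
      P {ω | ∀ j < n, ω j = c j} = ∏ j ∈ Finset.range n, ENNReal.ofReal (q (c j)))
    (η' : (ω : ℕ → I) → Measure ((n : ℕ) → Fin (k (ω n))))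
    (hη'prob : ∀ ω, IsProbabilityMeasure (η' ω))
    (hη'cyl : ∀ (ω : ℕ → I) (n : ℕ) (c : (j : ℕ) → Fin (k (ω j))),
      η' ω {u | ∀ j < n, u j = c j} = ∏ j ∈ Finset.range n, ENNReal.ofReal (p (ω j) (c j)))
    (hSSC : ∀ ω : ℕ → I, ∀ u v : Fin (k (ω 0)), u ≠ v →
      Disjoint ((fun x => r (ω 0) * x + t (ω 0) u) '' Yset k r t (shiftSeq ω))
               ((fun x => r (ω 0) * x + t (ω 0) v) '' Yset k r t (shiftSeq ω)))
    (hsep : ∀ ω : ℕ → I, ∀ u v : Fin (k (ω 0)), u ≠ v →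
      ∀ x ∈ (fun x => r (ω 0) * x + t (ω 0) u) '' Yset k r t (shiftSeq ω),
      ∀ y ∈ (fun x => r (ω 0) * x + t (ω 0) v) '' Yset k r t (shiftSeq ω),
        2 < |x - y|) :
    ∀ᵐ ω ∂P, ∀ᵐ u ∂(η' ω), ∀ f : C(ProbabilityMeasure ℝ, ℝ),
      Tendsto (fun T : ℝ => T⁻¹ * ∫ τ in (0:ℝ)..T, f (scenery k r t η' ω u τ))
        atTop
        (𝓝 ((∫ ω', -Real.log (r (ω' 0)) ∂P)⁻¹ *
          ∫ ω', (∫ u', (∫ τ in (0:ℝ)..(-Real.log (r (ω' 0))),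
            f (scenery k r t η' ω' u' τ)) ∂(η' ω')) ∂P)) := by
  let π : (i : I) → Measure (Fin (k i)) := fun i => weightMeasure (p i)
  have hπprob : ∀ i, IsProbabilityMeasure (π i) := fun i =>
    isProbabilityMeasure_weightMeasure (fun j => (hp i j).le) (hpsum i)
  have hπs : ∀ i j, π i {j} = ENNReal.ofReal (p i j) := fun i j => weightMeasure_singleton _ _
  have hπ : ∀ i j, π i {j} ≠ 0 := fun i j => by simpa [hπs] using hp i j
  have hsel : ∀ ω : ℕ → I, Measurable fun (θ : ℕ → (i : I) → Fin (k i)) n => θ n (ω n) :=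
    fun ω => by fun_prop
  have hη : ∀ ω, η' ω = (choiceLaw π).map fun θ n => θ n (ω n) := by
    refine fun ω => ext_of_cylinder fun n c => ?_
    have hcyl : MeasurableSet {u : (n : ℕ) → Fin (k (ω n)) | ∀ j < n, u j = c j} := by
      have : {u : (n : ℕ) → Fin (k (ω n)) | ∀ j < n, u j = c j}
          = Set.pi (Finset.range n) fun j => {c j} := by
        ext u; simp [Set.mem_pi]
      rw [this]
      exact .pi (Finset.countable_toSet _) fun j _ => measurableSet_singleton _
    rw [Measure.map_apply (hsel ω) hcyl, hη'cyl]
    simp only [← hπs]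
    exact (choiceLaw_cylinder ω n c).symm
  let w : (Σ i, Fin (k i)) → ℝ := fun a => q a.1 * p a.1 a.2
  let β := weightMeasure w
  have hβprob : IsProbabilityMeasure β := by
    refine isProbabilityMeasure_weightMeasure (fun a => (mul_pos (hq _) (hp _ _)).le) ?_
    simp only [w, Fintype.sum_sigma, ← Finset.mul_sum, hpsum, mul_one, hqsum]
  set B := Measure.infinitePi fun _ : ℕ => β
  let Ψ : (ℕ → I) × (ℕ → (i : I) → Fin (k i)) → ℕ → Σ i, Fin (k i) :=
    fun z n => ⟨z.1 n, z.2 n (z.1 n)⟩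
  have hmapB : (P.prod (choiceLaw π)).map Ψ = B :=
    map_choiceLaw_prod (w := fun i => ENNReal.ofReal (q i)) hPcyl fun a => by
      rw [hπs, ← ENNReal.ofReal_mul (hq _).le]; exact weightMeasure_singleton _ _
  have hΨ : AEMeasurable Ψ (P.prod (choiceLaw π)) := by
    by_contra h
    rw [Measure.map_of_not_aemeasurable h] at hmapB
    exact IsProbabilityMeasure.ne_zero B hmapB.symm
  have hpath : ∀ ω : ℕ → I, Measurable fun (u : (n : ℕ) → Fin (k (ω n))) n =>
      (⟨ω n, u n⟩ : Σ i, Fin (k i)) := fun ω =>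
    measurable_pi_lambda _ fun n => (Measurable.of_discrete (f := Sigma.mk (ω n))).comp
      (measurable_pi_apply n)
  have hint : ∀ G : (ℕ → Σ i, Fin (k i)) → ℝ, Continuous G → (∃ M, ∀ x, |G x| ≤ M) →
      ∫ y, G y ∂B = ∫ ω, (∫ u, G (fun n => ⟨ω n, u n⟩) ∂(η' ω)) ∂P := by
    rintro G hG ⟨M, hM⟩
    rw [← hmapB, integral_map hΨ hG.measurable.aestronglyMeasurable, integral_prod]
    · refine integral_congr_ae (Eventually.of_forall fun ω => ?_)
      simp only
      rw [hη ω]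
      exact (integral_map (hsel ω).aemeasurable
        (hG.measurable.comp (hpath ω)).aestronglyMeasurable).symm
    · exact Integrable.of_bound (hG.measurable.comp_aemeasurable hΨ).aestronglyMeasurable M
        (Eventually.of_forall fun z => hM _)
  obtain ⟨S, hSae, hSm, hS⟩ := (ae_tendsto_average_continuous β).exists_measurable_mem
  have hprod : ∀ᵐ z ∂P.prod (choiceLaw π), Ψ z ∈ S := by
    refine ae_of_ae_map hΨ ?_
    rw [hmapB]
    exact hSae
  filter_upwards [Measure.ae_ae_of_ae_prod hprod] with ω hω
  have hu : ∀ᵐ u ∂(η' ω), (fun n => (⟨ω n, u n⟩ : Σ i, Fin (k i))) ∈ S := by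
    rw [hη ω]
    exact (ae_map_iff (hsel ω).aemeasurable (hpath ω hSm)).2 hω
  filter_upwards [hu] with u hu f
  obtain ⟨M, hM⟩ := exists_bound_choiceScenery hr t hπ f
  have hlog : ∀ i, 0 < -Real.log (r i) := fun i => neg_pos.2 (Real.log_neg (hr i).1 (hr i).2)
  have hsc : ∀ (ω : ℕ → I) (u : (n : ℕ) → Fin (k (ω n))) (T : ℝ), 0 ≤ T →
      ∫ τ in (0 : ℝ)..T, f (scenery k r t η' ω u τ)
        = ∫ τ in (0 : ℝ)..T, f (choiceScenery k r t π (fun n => ⟨ω n, u n⟩) τ) := by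
    refine fun ω u T hT => intervalIntegral.integral_congr fun τ hτ => ?_
    rw [Set.uIcc_of_le hT] at hτ
    exact congrArg f (scenery_eq_choiceScenery hr t hπ hη ω u hτ.1)
  have hL : ∫ y, -Real.log (r (y 0).1) ∂B = ∫ ω, -Real.log (r (ω 0)) ∂P := by
    obtain ⟨i₁, hi₁⟩ := Finite.exists_max fun i => -Real.log (r i)
    have hc : Continuous fun a : Σ i, Fin (k i) => -Real.log (r a.1) :=
      continuous_of_discreteTopology
    rw [hint (fun y => -Real.log (r (y 0).1)) (hc.comp (continuous_apply 0))
      ⟨-Real.log (r i₁), fun y => (abs_of_pos (hlog _)).trans_le (hi₁ _)⟩]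
    simp
  have hF : ∫ y, (∫ τ in (0 : ℝ)..-Real.log (r (y 0).1), f (choiceScenery k r t π y τ)) ∂B
      = ∫ ω, (∫ u, (∫ τ in (0 : ℝ)..-Real.log (r (ω 0)), f (scenery k r t η' ω u τ))
        ∂(η' ω)) ∂P := by
    obtain ⟨i₁, hi₁⟩ := Finite.exists_max fun i => -Real.log (r i)
    rw [hint _ (continuous_integral_choiceScenery hr t hπ f fun i => -Real.log (r i))
      ⟨M * -Real.log (r i₁), fun y => ?_⟩]
    · simp only [hsc _ _ _ (hlog _).le]
    · refine (intervalIntegral.norm_integral_le_of_norm_le_const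
        (f := fun τ => f (choiceScenery k r t π y τ)) fun τ _ => hM y τ).trans ?_
      rw [sub_zero, abs_of_pos (hlog _)]
      exact mul_le_mul_of_nonneg_left (hi₁ _) ((abs_nonneg _).trans (hM y 0))
  rw [← hL, ← hF]
  refine (tendsto_time_average_choiceScenery hr t hπ (two_lt_abs_codeSeq_redigit_sub hr t hsep)
    (hS _ hu) f).congr' ?_
  filter_upwards [eventually_ge_atTop 0] with T hT
  rw [hsc _ _ _ hT]
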